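/- For every σ > 0, κ ≥ 0 and L-periodic continuous W, V : ℝ → ℝ, the map T possesses at least one fixed point: there exists a continuous, L-periodic, strictly positive function u with ∫_Ω u dx = 1 and u = T u. Equivalently, the stationary aggregation–diffusion problem admits a stationary state of unit mass. -/

import Mathlib

open MeasureTheory Real Set

/-- Periodic convolution over Ω = (-L/2, L/2]: `(W*u)(x) = ∫_Ω W(x-y) u(y) dy`. -/
noncomputable def pconv (L : ℝ) (W u : ℝ → ℝ) (x : ℝ) : ℝ :=
  ∫ y in Set.Ioc (-(L/2)) (L/2), W (x - y) * u y

/-- Normalisation constant `Z(u)`. -/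
noncomputable def Zfun (L σ κ : ℝ) (W V u : ℝ → ℝ) : ℝ :=
  ∫ y in Set.Ioc (-(L/2)) (L/2), Real.exp (-σ⁻¹ * (κ * pconv L W u y + V y))

/-- The fixed-point map `T`. -/
noncomputable def Tmap (L σ κ : ℝ) (W V u : ℝ → ℝ) (x : ℝ) : ℝ :=
  Real.exp (-σ⁻¹ * (κ * pconv L W u x + V x)) / Zfun L σ κ W V u

section Brouwer

variable {E : Type*} [NormedAddCommGroup E]

lemma ContinuousLinearMap.exists_polynomial_eval_eq_det_one_add_smul [NormedSpace ℝ E]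
    [FiniteDimensional ℝ E] (A : E →L[ℝ] E) :
    ∃ p : Polynomial ℝ, p.natDegree ≤ Module.finrank ℝ E ∧ ∀ t : ℝ, p.eval t = (1 + t • A).det := by
  classical
  let b := Module.finBasis ℝ E
  let M := LinearMap.toMatrix b b (A : E →ₗ[ℝ] E)
  refine ⟨((Polynomial.X : Polynomial ℝ) • M.map Polynomial.C
      + (1 : Matrix _ _ ℝ).map Polynomial.C).det, ?_, fun t => ?_⟩
  · simpa using Polynomial.natDegree_det_X_add_C_le M 1
  · have h : LinearMap.toMatrix b b ((1 + t • A : E →L[ℝ] E) : E →ₗ[ℝ] E) = 1 + t • M := by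
      simp [M, ContinuousLinearMap.one_def]
    rw [ContinuousLinearMap.det, ← LinearMap.det_toMatrix b, h, ← Polynomial.coe_evalRingHom,
      RingHom.map_det]
    congr 1
    ext i j
    simp [Matrix.one_apply, add_comm]
    split_ifs <;> simp [mul_comm]

lemma LipschitzOnWith.lipschitzWith_indicator_closedBall [NormedSpace ℝ E] {F : Type*}
    [NormedAddCommGroup F] {h : E → F} {C : NNReal} {ρ : ℝ}
    (hh : LipschitzOnWith C h (Metric.closedBall 0 ρ)) (h0 : ∀ x, ‖x‖ = ρ → h x = 0) :
    LipschitzWith C ((Metric.closedBall 0 ρ).indicator h) := by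
  have key : ∀ x y : E, x ∈ Metric.closedBall (0 : E) ρ → y ∉ Metric.closedBall (0 : E) ρ →
      dist (h x) 0 ≤ C * dist x y := by
    intro x y hx hy
    rw [mem_closedBall_zero_iff] at hx hy
    have hc : Continuous fun t : ℝ => ‖AffineMap.lineMap (k := ℝ) x y t‖ :=
      AffineMap.lineMap_continuous.norm
    obtain ⟨t, ht, hzt⟩ := intermediate_value_Icc zero_le_one hc.continuousOn
      (show ρ ∈ Icc _ _ by simpa using ⟨hx, (not_le.1 hy).le⟩)
    have hz := hh.dist_le_mul x (by simpa using hx) (AffineMap.lineMap x y t)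
      (by simpa using hzt.le)
    rw [h0 _ hzt, dist_left_lineMap, Real.norm_of_nonneg ht.1] at hz
    refine hz.trans ?_
    have := mul_le_of_le_one_left (dist_nonneg (x := x) (y := y)) ht.2
    gcongr
  refine LipschitzWith.of_dist_le_mul fun x y => ?_
  by_cases hx : x ∈ Metric.closedBall (0 : E) ρ <;> by_cases hy : y ∈ Metric.closedBall (0 : E) ρ
  · simpa only [indicator_of_mem hx, indicator_of_mem hy] using hh.dist_le_mul x hx y hy
  · simpa only [indicator_of_mem hx, indicator_of_notMem hy] using key x y hx hy
  · rw [dist_comm, dist_comm x y]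
    simpa only [indicator_of_mem hy, indicator_of_notMem hx] using key y x hy hx
  · simp only [indicator_of_notMem hx, indicator_of_notMem hy, dist_self]
    positivity

lemma LipschitzWith.bijective_id_add_smul [NormedSpace ℝ E] [CompleteSpace E] {g : E → E}
    {C : NNReal} (hg : LipschitzWith C g) {t : ℝ} (ht : 0 ≤ t) (htC : t * C < 1) :
    Function.Bijective fun x => x + t • g x := by
  lift t to NNReal using ht
  have happ : ApproximatesLinearOn (fun x => x + (t : ℝ) • g x)
      ((ContinuousLinearEquiv.refl ℝ E : E ≃L[ℝ] E) : E →L[ℝ] E) univ (t * C) := by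
    intro x _ y _
    have h := hg.dist_le_mul x y
    have e : x + (t : ℝ) • g x - (y + (t : ℝ) • g y) -
        ((ContinuousLinearEquiv.refl ℝ E : E ≃L[ℝ] E) : E →L[ℝ] E) (x - y)
        = (t : ℝ) • (g x - g y) := by
      simp [smul_sub]; abel
    rw [dist_eq_norm, dist_eq_norm] at h
    rw [e, norm_smul, Real.norm_of_nonneg t.coe_nonneg, NNReal.coe_mul, mul_assoc]
    gcongr
  have hc : Subsingleton E ∨
      t * C < ‖((ContinuousLinearEquiv.refl ℝ E : E ≃L[ℝ] E).symm : E →L[ℝ] E)‖₊⁻¹ := by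
    rcases subsingleton_or_nontrivial E with h | h
    · exact Or.inl h
    · right
      have : ‖((ContinuousLinearEquiv.refl ℝ E : E ≃L[ℝ] E).symm : E →L[ℝ] E)‖₊ = 1 := by
        apply NNReal.eq
        simp
      rw [this, inv_one]
      exact_mod_cast htC
  refine ⟨fun x y hxy => ?_, happ.surjective hc⟩
  have := happ.injective hc (a₁ := ⟨x, mem_univ x⟩) (a₂ := ⟨y, mem_univ y⟩) hxy
  simpa using this

lemma not_forall_det_fderiv_eq_zero_of_eq_on_sphere [NormedSpace ℝ E] [FiniteDimensional ℝ E]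
    {r : E → E} (hr : ContDiff ℝ 1 r) {ρ : ℝ} (hρ : 0 < ρ) (hs : ∀ x, ‖x‖ = ρ → r x = x) :
    ¬ ∀ x, ‖x‖ < ρ → (fderiv ℝ r x).det = 0 := by
  intro hdet
  let _ : MeasurableSpace E := borel E
  have : BorelSpace E := ⟨rfl⟩
  let μ : Measure E := Measure.addHaar
  let A : E → E →L[ℝ] E := fun x => fderiv ℝ r x - 1
  have hA : Continuous A := (hr.continuous_fderiv one_ne_zero).sub continuous_const
  let B := Metric.ball (0 : E) ρ
  let K := Metric.closedBall (0 : E) ρ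
  have hK : IsCompact K := isCompact_closedBall _ _
  obtain ⟨C', hC'⟩ := hK.exists_bound_of_continuousOn hA.continuousOn
  let C : NNReal := Real.toNNReal C'
  have hC : ∀ x ∈ K, ‖A x‖ ≤ C := fun x hx => (hC' x hx).trans (Real.le_coe_toNNReal _)
  let h : E → E := fun x => r x - x
  have hd : ∀ x, HasFDerivAt h (A x) x := fun x =>
    ((hr.differentiable one_ne_zero x).hasFDerivAt).sub (hasFDerivAt_id x)
  have hlip : LipschitzOnWith C h K :=
    (convex_closedBall _ _).lipschitzOnWith_of_nnnorm_hasFDerivWithin_le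
      (fun x _ => (hd x).hasFDerivWithinAt) (fun x hx => hC x hx)
  have hg := hlip.lipschitzWith_indicator_closedBall fun x hx => by simp [h, hs x hx]
  obtain ⟨δ, hδ, hpos⟩ : ∃ δ > 0, ∀ S : E →L[ℝ] E, ‖S‖ < δ → 0 < (1 + S).det := by
    have hcont : Continuous fun S : E →L[ℝ] E => (1 + S).det :=
      ContinuousLinearMap.continuous_det.comp (continuous_const.add continuous_id)
    have h1 : 0 < (1 + (0 : E →L[ℝ] E)).det := by
      simp [ContinuousLinearMap.det, ContinuousLinearMap.one_def]
    obtain ⟨δ, hδ, hsub⟩ := Metric.mem_nhds_iff.1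
      ((isOpen_Ioi.preimage hcont).mem_nhds (show (0 : E →L[ℝ] E) ∈ _ from h1))
    exact ⟨δ, hδ, fun S hS => hsub (by simpa using hS)⟩
  have hint : ∀ t : ℝ, IntegrableOn (fun x => (1 + t • A x).det) B μ := fun t =>
    ((ContinuousLinearMap.continuous_det.comp
      (continuous_const.add (hA.const_smul t))).continuousOn.integrableOn_compact hK).mono_set
      Metric.ball_subset_closedBall
  have hvol : ∀ t : ℝ, 0 ≤ t → t * C < 1 → t * C < δ →
      ∫ x in B, (1 + t • A x).det ∂μ = μ.real B := by
    intro t ht ht1 htδ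
    let f : E → E := fun x => x + t • K.indicator h x
    have hf : Function.Bijective f := hg.bijective_id_add_smul ht ht1
    have hfix : ∀ x ∈ Bᶜ, f x = x := by
      intro x hx
      by_cases hxK : x ∈ K
      · have hxρ : ‖x‖ = ρ := le_antisymm (by simpa [K] using hxK) (by simpa [B] using hx)
        simp [f, h, hs x hxρ]
      · simp [f, hxK]
    have himage : f '' B = B := by
      rw [← compl_inj_iff, ← image_compl_eq hf, image_congr hfix, image_id']
    have hfB : EqOn f (id + t • h) B := fun x hx => by
      simp [f, indicator_of_mem (Metric.ball_subset_closedBall hx) h, K]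
    have hf' : ∀ x ∈ B, HasFDerivWithinAt f (1 + t • A x) B x := fun x hx =>
      ((hasFDerivAt_id x).add ((hd x).const_smul t)).hasFDerivWithinAt.congr hfB (hfB hx)
    have key := integral_image_eq_integral_abs_det_fderiv_smul μ Metric.isOpen_ball.measurableSet
      hf' hf.1.injOn (fun _ => (1 : ℝ))
    rw [himage] at key
    simp only [smul_eq_mul, mul_one, integral_const, measureReal_restrict_apply_univ] at key
    rw [key]
    refine setIntegral_congr_fun Metric.isOpen_ball.measurableSet fun x hx => ?_
    refine (abs_of_pos (hpos _ ?_)).symm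
    rw [norm_smul, Real.norm_of_nonneg ht]
    exact (mul_le_mul_of_nonneg_left (hC x (Metric.ball_subset_closedBall hx)) ht).trans_lt htδ
  -- The integral is a polynomial in `t`, so its value at `1` follows from those at small nodes.
  let n := Module.finrank ℝ E
  let s := Finset.range (n + 1)
  let ε : ℝ := min 1 δ / (2 * (n + 1) * (C + 1))
  have hε : 0 < ε := by positivity
  let v : ℕ → ℝ := fun i => i * ε
  have hv : Set.InjOn v s := fun i _ j _ hij => by
    simpa [v, hε.ne'] using hij
  have hvC : ∀ i ∈ s, 0 ≤ v i ∧ v i * C < min 1 δ := by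
    intro i hi
    have hi' : (i : ℝ) ≤ n + 1 := by exact_mod_cast (Finset.mem_range.1 hi).le
    refine ⟨by positivity, ?_⟩
    have hm : 0 < min 1 δ := by positivity
    calc v i * C ≤ (n + 1) * ε * (C + 1) := by
          simp only [v]; gcongr; simp
      _ = min 1 δ / 2 := by simp only [ε]; field_simp
      _ < min 1 δ := half_lt_self hm
  have hinterp : ∀ x, (fderiv ℝ r x).det =
      ∑ i ∈ s, (Lagrange.basis s v i).eval 1 * (1 + v i • A x).det := by
    intro x
    obtain ⟨p, hp, hpe⟩ := (A x).exists_polynomial_eval_eq_det_one_add_smul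
    have hdeg : p.degree < s.card := by
      refine Polynomial.degree_le_natDegree.trans_lt ?_
      simp only [s, Finset.card_range]
      exact_mod_cast Nat.lt_succ_of_le hp
    have h1 := congrArg (Polynomial.eval 1) (Lagrange.eq_interpolate hv hdeg)
    rw [hpe 1, Lagrange.interpolate_apply, Polynomial.eval_finsetSum] at h1
    have h2 : 1 + (1 : ℝ) • A x = fderiv ℝ r x := by simp [A]
    rw [← h2, h1]
    refine Finset.sum_congr rfl fun i _ => ?_
    rw [Polynomial.eval_mul, Polynomial.eval_C, hpe, mul_comm]
  have hsum : ∑ i ∈ s, (Lagrange.basis s v i).eval 1 = 1 := by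
    rw [← Polynomial.eval_finsetSum, Lagrange.sum_basis hv ⟨0, by simp [s]⟩, Polynomial.eval_one]
  have hzero : ∫ x in B, (fderiv ℝ r x).det ∂μ = 0 := by
    rw [setIntegral_congr_fun (g := fun _ => (0 : ℝ)) Metric.isOpen_ball.measurableSet
      fun x hx => hdet x (by simpa [B] using hx)]
    simp
  have hone : ∫ x in B, (fderiv ℝ r x).det ∂μ = μ.real B := by
    simp_rw [hinterp]
    rw [integral_finsetSum _ fun i _ => (hint _).const_mul _]
    calc _ = ∑ i ∈ s, (Lagrange.basis s v i).eval 1 * μ.real B := by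
          refine Finset.sum_congr rfl fun i hi => ?_
          obtain ⟨h0, h1⟩ := hvC i hi
          rw [integral_const_mul, hvol _ h0 (h1.trans_le (min_le_left _ _))
            (h1.trans_le (min_le_right _ _))]
      _ = μ.real B := by rw [← Finset.sum_mul, hsum, one_mul]
  have hB : 0 < μ.real B :=
    ENNReal.toReal_pos (Metric.measure_ball_pos μ _ hρ).ne' measure_ball_lt_top.ne
  exact hB.ne' (hone.symm.trans hzero)

/-- Brouwer's fixed point theorem for bounded `C¹` self-maps of a Euclidean space. -/
theorem ContDiff.exists_fixedPoint_of_norm_le [InnerProductSpace ℝ E] [FiniteDimensional ℝ E]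
    {F : E → E} (hF : ContDiff ℝ 1 F) {R : ℝ} (hR : ∀ x, ‖F x‖ ≤ R) : ∃ x, F x = x := by
  by_contra! hne
  have hR0 : 0 ≤ R := (norm_nonneg _).trans (hR 0)
  let χ : ContDiffBump (0 : E) := ⟨R + 1, R + 2, by linarith, by linarith⟩
  let ρ := R + 2
  have hρ : 0 < ρ := by positivity
  let G : E → E := fun x => x - χ x • F x
  have hG : ContDiff ℝ 1 G := contDiff_id.sub (χ.contDiff.smul hF)
  have hG0 : ∀ x, G x ≠ 0 := by
    intro x hx
    have hx' : x = χ x • F x := sub_eq_zero.1 hx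
    have hn : ‖x‖ ≤ R := by
      rw [hx', norm_smul, Real.norm_of_nonneg χ.nonneg]
      exact (mul_le_of_le_one_left (norm_nonneg _) χ.le_one).trans (hR x)
    have h1 : χ x = 1 := χ.one_of_mem_closedBall (by
      rw [mem_closedBall_zero_iff]; exact hn.trans (by simp [χ]))
    rw [h1, one_smul] at hx'
    exact hne x hx'.symm
  let r : E → E := fun x => (ρ * ‖G x‖⁻¹) • G x
  have hr : ContDiff ℝ 1 r :=
    (contDiff_const.mul ((hG.norm ℝ hG0).inv fun x => norm_ne_zero_iff.2 (hG0 x))).smul hG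
  have hrn : ∀ x, ‖r x‖ = ρ := fun x => by
    have := norm_ne_zero_iff.2 (hG0 x)
    simp only [r]
    rw [norm_smul, norm_mul, norm_inv, norm_norm, Real.norm_of_nonneg hρ.le]
    field_simp
  refine not_forall_det_fderiv_eq_zero_of_eq_on_sphere hr hρ (fun x hx => ?_) fun x _ => ?_
  · have h0 : χ x = 0 := χ.zero_of_le_dist (by simp [χ, hx, ρ])
    have hGx : G x = x := by simp [G, h0]
    simp only [r]
    rw [hGx, hx, mul_inv_cancel₀ hρ.ne', one_smul]
  · by_contra hdet
    have hd := (hr.differentiable one_ne_zero x).hasFDerivAt.norm_sq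
    simp only [hrn] at hd
    have h0 := hd.unique (hasFDerivAt_const (ρ ^ 2) x)
    obtain ⟨w, hw⟩ : ∃ w, fderiv ℝ r x w = r x :=
      ((LinearMap.equivOfDetNeZero _ hdet).surjective (r x))
    have h1 := congrArg (fun l => l w) h0
    simp [hw, hrn, hρ.ne'] at h1

end Brouwer

section Gibbs

open Filter Topology

lemma exists_weighted_softmax_fixedPoint {ι : Type*} [Fintype ι] (A : ι → ι → ℝ) (b w : ι → ℝ)
    (hw : ∀ i, 0 ≤ w i) (hw_sum : 0 < ∑ i, w i) :
    ∃ m : ι → ℝ, ∀ i, m i = w i * exp (∑ j, A i j * m j + b i) /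
      ∑ k, w k * exp (∑ j, A k j * m j + b k) := by
  let N : EuclideanSpace ℝ ι → ι → ℝ := fun x i => w i * exp (∑ j, A i j * x j + b i)
  have hN0 : ∀ x i, 0 ≤ N x i := fun x i => mul_nonneg (hw i) (exp_pos _).le
  have hZ : ∀ x, 0 < ∑ k, N x k := by
    intro x
    obtain ⟨i, -, hi⟩ := Finset.exists_ne_zero_of_sum_ne_zero hw_sum.ne'
    exact Finset.sum_pos' (fun i _ => hN0 x i)
      ⟨i, Finset.mem_univ i, mul_pos ((hw i).lt_of_ne' hi) (exp_pos _)⟩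
  have hN : ∀ i, ContDiff ℝ 1 fun x => N x i := fun i => by
    simp only [N]
    fun_prop
  let F : EuclideanSpace ℝ ι → EuclideanSpace ℝ ι :=
    fun x => WithLp.toLp 2 fun i => N x i / ∑ k, N x k
  have hF : ContDiff ℝ 1 F := contDiff_euclidean.2 fun i =>
    (hN i).div (ContDiff.sum fun k _ => hN k) fun x => (hZ x).ne'
  have hbound : ∀ x, ‖F x‖ ≤ √(Fintype.card ι) := by
    intro x
    rw [EuclideanSpace.norm_eq]
    refine Real.sqrt_le_sqrt ?_
    calc ∑ i, ‖F x i‖ ^ 2 ≤ ∑ _i : ι, (1 : ℝ) := by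
          refine Finset.sum_le_sum fun i _ => pow_le_one₀ (norm_nonneg _) ?_
          simp only [F]
          rw [Real.norm_of_nonneg (div_nonneg (hN0 x i) (hZ x).le)]
          exact div_le_one_of_le₀
            (Finset.single_le_sum (fun k _ => hN0 x k) (Finset.mem_univ i)) (hZ x).le
      _ = Fintype.card ι := by simp
  obtain ⟨x, hx⟩ := hF.exists_fixedPoint_of_norm_le hbound
  exact ⟨x, fun i => (congrArg (fun y : EuclideanSpace ℝ ι => y i) hx).symm⟩

variable {X : Type*} [MeasurableSpace X]

lemma MeasureTheory.SimpleFunc.integral_comp_eq_sum_range {α : Type*} [MeasurableSpace α]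
    [MeasurableSingletonClass X] (μ : Measure α) [IsFiniteMeasure μ] (s : SimpleFunc α X)
    (f : X → ℝ) : ∫ y, f (s y) ∂μ = ∑ i : s.range, μ.real (s ⁻¹' {(i : X)}) * f i := by
  let t : α → s.range := fun y => ⟨s y, s.mem_range_self y⟩
  have ht : Measurable t := s.measurable.subtype_mk
  have h := integral_map (μ := μ) ht.aemeasurable
    (f := fun i : s.range => f i) (measurable_of_finite _).aestronglyMeasurable
  rw [integral_fintype .of_finite] at h
  refine h.symm.trans (Finset.sum_congr rfl fun i _ => ?_)
  rw [map_measureReal_apply ht (measurableSet_singleton i), smul_eq_mul]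
  congr 2
  ext y
  simp [t, Subtype.ext_iff]

variable [MetricSpace X] [CompactSpace X] [BorelSpace X]

lemma exists_gibbs_fixedPoint_simpleFunc (μ : Measure X) [IsFiniteMeasure μ] [NeZero μ]
    (k : X → C(X, ℝ)) (b : X → ℝ) (s : SimpleFunc X X) :
    ∃ U ∈ convexHull ℝ (range k), ∀ x, U x =
      (∫ y, k (s y) x * exp (U (s y) + b (s y)) ∂μ) / ∫ y, exp (U (s y) + b (s y)) ∂μ := by
  let w : s.range → ℝ := fun i => μ.real (s ⁻¹' {(i : X)})
  have hw : ∀ i, 0 ≤ w i := fun i => measureReal_nonneg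
  have hw_sum : 0 < ∑ i, w i := by
    have h := s.integral_comp_eq_sum_range μ (fun _ => (1 : ℝ))
    simp only [mul_one, integral_const, smul_eq_mul] at h
    simp only [w, ← h]
    exact measureReal_univ_pos
  obtain ⟨m, hm⟩ := exists_weighted_softmax_fixedPoint (fun i j : s.range => k j i)
    (fun i => b i) w hw hw_sum
  let U : C(X, ℝ) := ∑ j, m j • k j
  have hU : ∀ x, U x = ∑ j : s.range, k j x * m j := fun x => by
    simp [U, ContinuousMap.sum_apply, mul_comm]
  simp only [← hU] at hm
  have hZ : 0 < ∑ i, w i * exp (U i + b i) := by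
    obtain ⟨i, -, hi⟩ := Finset.exists_ne_zero_of_sum_ne_zero hw_sum.ne'
    exact Finset.sum_pos' (fun i _ => mul_nonneg (hw i) (exp_pos _).le)
      ⟨i, Finset.mem_univ i, mul_pos ((hw i).lt_of_ne' hi) (exp_pos _)⟩
  refine ⟨U, (convex_convexHull ℝ _).sum_mem (fun i _ => ?_) ?_
    (fun i _ => subset_convexHull ℝ _ (mem_range_self _)), fun x => ?_⟩
  · rw [hm]
    exact div_nonneg (mul_nonneg (hw i) (exp_pos _).le) hZ.le
  · rw [Finset.sum_congr rfl fun i _ => hm i, ← Finset.sum_div, div_self hZ.ne']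
  · rw [s.integral_comp_eq_sum_range μ fun y => k y x * exp (U y + b y),
      s.integral_comp_eq_sum_range μ fun y => exp (U y + b y), hU, Finset.sum_div]
    refine Finset.sum_congr rfl fun i _ => ?_
    rw [hm]
    simp only [w]
    ring

theorem exists_gibbs_fixedPoint (μ : Measure X) [IsFiniteMeasure μ] [NeZero μ]
    (k : C(X, C(X, ℝ))) (b : C(X, ℝ)) :
    ∃ U : C(X, ℝ), ∀ x, U x =
      (∫ y, k y x * exp (U y + b y) ∂μ) / ∫ y, exp (U y + b y) ∂μ := by
  obtain ⟨x₀⟩ : Nonempty X := μ.nonempty_of_neZero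
  let s : ℕ → SimpleFunc X X := SimpleFunc.approxOn id measurable_id univ x₀ (mem_univ _)
  have hs : ∀ y, Tendsto (fun n => s n y) atTop (𝓝 y) := fun y =>
    SimpleFunc.tendsto_approxOn measurable_id (mem_univ x₀) (by simp)
  choose u hu_mem hu using fun n => exists_gibbs_fixedPoint_simpleFunc μ k b (s n)
  have hcompact : IsCompact (closure (convexHull ℝ (range k))) :=
    (totallyBounded_convexHull.2
      (isCompact_range k.continuous).totallyBounded).closure.isCompact_of_isClosed isClosed_closure
  obtain ⟨U, -, φ, hφ, hlim⟩ := hcompact.tendsto_subseq fun n => subset_closure (hu_mem n)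
  have hnorm : ∀ n, ‖u n‖ ≤ ‖k‖ := by
    intro n
    have hsub : range k ⊆ Metric.closedBall 0 ‖k‖ := by
      rintro _ ⟨y, rfl⟩
      simpa using k.norm_coe_le_norm y
    simpa using convexHull_min hsub (convex_closedBall _ _) (hu_mem n)
  have hs' : ∀ y, Tendsto (fun n => s (φ n) y) atTop (𝓝 y) := fun y =>
    (hs y).comp hφ.tendsto_atTop
  have hexp : ∀ y, Tendsto (fun n => exp (u (φ n) (s (φ n) y) + b (s (φ n) y))) atTop
      (𝓝 (exp (U y + b y))) := fun y =>
    (Real.continuous_exp.tendsto _).comp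
      (((continuous_eval.tendsto (U, y)).comp (hlim.prodMk_nhds (hs' y))).add
        ((b.continuous.tendsto y).comp (hs' y)))
  have hexp_le : ∀ n y, ‖exp (u n y + b y)‖ ≤ exp (‖k‖ + ‖b‖) := by
    intro n y
    rw [Real.norm_of_nonneg (exp_pos _).le, exp_le_exp]
    exact add_le_add (((le_abs_self _).trans ((u n).norm_coe_le_norm y)).trans (hnorm n))
      ((le_abs_self _).trans (b.norm_coe_le_norm y))
  have hexp_cont : ∀ n, Continuous fun y => exp (u n y + b y) := fun n => by fun_prop
  have hden : Tendsto (fun n => ∫ y, exp (u (φ n) (s (φ n) y) + b (s (φ n) y)) ∂μ) atTop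
      (𝓝 (∫ y, exp (U y + b y) ∂μ)) :=
    tendsto_integral_of_dominated_convergence (fun _ => exp (‖k‖ + ‖b‖))
      (fun n => ((hexp_cont _).measurable.comp (s (φ n)).measurable).aestronglyMeasurable)
      (integrable_const _) (fun n => .of_forall fun y => hexp_le _ _) (.of_forall hexp)
  have hpos : 0 < ∫ y, exp (U y + b y) ∂μ := by
    have hc : Continuous fun y => exp (U y + b y) := by fun_prop
    refine integral_exp_pos (f := fun y => U y + b y) ?_
    exact hc.integrable_of_hasCompactSupport (HasCompactSupport.of_compactSpace _)
  refine ⟨U, fun x => ?_⟩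
  have hk_cont : Continuous fun y => k y x :=
    (continuous_eval_const x).comp k.continuous
  have hnum : Tendsto
      (fun n => ∫ y, k (s (φ n) y) x * exp (u (φ n) (s (φ n) y) + b (s (φ n) y)) ∂μ) atTop
      (𝓝 (∫ y, k y x * exp (U y + b y) ∂μ)) := by
    refine tendsto_integral_of_dominated_convergence (fun _ => ‖k‖ * exp (‖k‖ + ‖b‖))
      (fun n => ((hk_cont.mul (hexp_cont _)).measurable.comp
        (s (φ n)).measurable).aestronglyMeasurable)
      (integrable_const _) (fun n => .of_forall fun y => ?_) (.of_forall fun y => ?_)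
    · rw [norm_mul]
      exact mul_le_mul (((k _).norm_coe_le_norm x).trans (k.norm_coe_le_norm _)) (hexp_le _ _)
        (norm_nonneg _) (norm_nonneg k)
    · exact ((hk_cont.tendsto y).comp (hs' y)).mul (hexp y)
  refine tendsto_nhds_unique
    (((continuous_eval_const x).tendsto U).comp hlim) ?_
  refine (hnum.div hden hpos.ne').congr fun n => ?_
  exact (hu (φ n) x).symm

end Gibbs

lemma continuous_pconv {L : ℝ} {W u : ℝ → ℝ} (hW : Continuous W) (hu : Continuous u) :
    Continuous (pconv L W u) := by
  rcases le_total (-(L / 2)) (L / 2) with h | h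
  · have : pconv L W u = fun x => ∫ y in (-(L / 2))..(L / 2), W (x - y) * u y := by
      ext x
      rw [intervalIntegral.integral_of_le h, pconv]
    rw [this]
    exact intervalIntegral.continuous_parametric_intervalIntegral_of_continuous'
      (by fun_prop) _ _
  · have : pconv L W u = fun _ => 0 := by
      ext x
      simp [pconv, Ioc_eq_empty_of_le h]
    rw [this]
    exact continuous_const

lemma periodic_pconv {L : ℝ} {W : ℝ → ℝ} (hW : Function.Periodic W L) (u : ℝ → ℝ) :
    Function.Periodic (pconv L W u) L := fun x => by
  simp only [pconv, add_sub_right_comm, hW _]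

lemma pconv_congr {L : ℝ} {W u v : ℝ → ℝ} (h : EqOn u v (Ioc (-(L / 2)) (L / 2))) :
    pconv L W u = pconv L W v := by
  ext x
  exact setIntegral_congr_fun measurableSet_Ioc fun y hy => by simp only [h hy]

/-- For every `σ > 0`, `κ ≥ 0` and L-periodic continuous `W, V`, the map `T`
possesses at least one fixed point which is continuous, L-periodic, strictly positive, and
of unit mass: the stationary problem admits a stationary state of unit mass. -/
theorem fixedPoint_exists (L σ κ : ℝ) (hL : 0 < L) (hσ : 0 < σ) (hκ : 0 ≤ κ)
    (W V : ℝ → ℝ) (hWc : Continuous W) (hWper : Function.Periodic W L)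
    (hVc : Continuous V) (hVper : Function.Periodic V L) :
    ∃ u : ℝ → ℝ, Continuous u ∧ Function.Periodic u L ∧ (∀ x : ℝ, 0 < u x) ∧
      (∫ x in Set.Ioc (-(L/2)) (L/2), u x) = 1 ∧ u = Tmap L σ κ W V u := by
  have hle : -(L / 2) ≤ L / 2 := by linarith
  let X : Set ℝ := Icc (-(L / 2)) (L / 2)
  let μ : Measure X := Measure.comap (↑) (volume : Measure ℝ)
  have hμ : μ univ = ENNReal.ofReal L := by
    rw [comap_subtype_coe_apply measurableSet_Icc, Subtype.coe_image_univ, Real.volume_Icc]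
    congr 1
    ring
  have : IsFiniteMeasure μ := ⟨by rw [hμ]; exact ENNReal.ofReal_lt_top⟩
  have : NeZero μ := ⟨fun h => by
    rw [h, Measure.coe_zero, Pi.zero_apply] at hμ
    exact hL.not_ge (ENNReal.ofReal_eq_zero.1 hμ.symm)⟩
  let k : C(X, C(X, ℝ)) := ContinuousMap.curry
    ⟨fun p : X × X => -σ⁻¹ * (κ * W (p.2 - p.1)), by fun_prop⟩
  let b : C(X, ℝ) := ⟨fun y => -σ⁻¹ * V y, by fun_prop⟩
  obtain ⟨U, hU⟩ := exists_gibbs_fixedPoint μ k b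
  let E : ℝ → ℝ := fun y => exp (U (projIcc _ _ hle y) + -σ⁻¹ * V y)
  have hE : Continuous E := by fun_prop
  have hEX : ∀ y : X, exp (U y + b y) = E y := fun y => by simp [E, b, projIcc_val]
  have hIoc : ∀ f : ℝ → ℝ, ∫ y : X, f y ∂μ = ∫ y in Ioc (-(L / 2)) (L / 2), f y := fun f => by
    rw [integral_subtype_comap measurableSet_Icc, integral_Icc_eq_integral_Ioc]
  let Z := ∫ y in Ioc (-(L / 2)) (L / 2), E y
  let v : ℝ → ℝ := fun y => E y / Z
  have hv : Continuous v := hE.div_const Z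
  have hUconv : ∀ x : X, U x = -σ⁻¹ * (κ * pconv L W v x) := by
    intro x
    rw [hU x]
    simp only [hEX]
    rw [hIoc E]
    change (∫ y : X, -σ⁻¹ * (κ * W (x - y)) * E y ∂μ) / Z = _
    rw [hIoc fun y => -σ⁻¹ * (κ * W (x - y)) * E y, pconv, ← integral_const_mul,
      ← integral_const_mul, ← integral_div]
    congr 1
    ext y
    simp only [v]
    ring
  have hEv : EqOn (fun y => exp (-σ⁻¹ * (κ * pconv L W v y + V y))) E
      (Ioc (-(L / 2)) (L / 2)) := by
    intro y hy
    have hyX : y ∈ X := Ioc_subset_Icc_self hy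
    simp only [E]
    rw [projIcc_of_mem hle hyX, hUconv, mul_add]
  have hZ : Zfun L σ κ W V v = Z := setIntegral_congr_fun measurableSet_Ioc hEv
  have hc : Continuous (pconv L W v) := continuous_pconv hWc hv
  have hZpos : 0 < Z := by
    have : NeZero (volume.restrict (Ioc (-(L / 2)) (L / 2))) := ⟨by
      rw [Ne, Measure.restrict_eq_zero, Real.volume_Ioc, ENNReal.ofReal_eq_zero]
      linarith⟩
    exact integral_exp_pos (f := fun y => U (projIcc _ _ hle y) + -σ⁻¹ * V y)
      (hE.integrableOn_Ioc)
  let u := Tmap L σ κ W V v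
  have hu : EqOn v u (Ioc (-(L / 2)) (L / 2)) := fun y hy => by
    simp only [u, Tmap, v, hZ]
    rw [← hEv hy]
  have hcongr : pconv L W v = pconv L W u := pconv_congr hu
  refine ⟨u, ?_, fun x => ?_, fun x => ?_, ?_, ?_⟩
  · exact Continuous.div_const (by fun_prop) _
  · simp only [u, Tmap, periodic_pconv hWper v x, hVper x]
  · simp only [u, Tmap, hZ]
    positivity
  · rw [← setIntegral_congr_fun measurableSet_Ioc hu, integral_div]
    exact div_self hZpos.ne'
  · ext x
    simp only [u, Tmap, Zfun]
    rw [← show pconv L W v = pconv L W (Tmap L σ κ W V v) from hcongr]
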